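/- arXiv:1909.02610 — 2 statements merged into one kernel-verified Lean document; each statement's English description precedes it below -/
import Mathlib

section
/- For every integer n ≥ 3, sdepth(I(C_{n,2})/I(P_{n,2})) ≥ ⌈(n+2)/3⌉, where I(C_{n,2})/I(P_{n,2}) is viewed as a Z^{2n}-graded module over S_{n,2} (note I(P_{n,2}) ⊆ I(C_{n,2}), since P_{n,2} is a subgraph of C_{n,2} on the same vertex set). -/
open MvPolynomial

section Defs

variable (K : Type) [Field K] (σ : Type)
variable (M : Type) [AddCommGroup M] [Module K M] [Module (MvPolynomial σ K) M]
  [IsScalarTower K (MvPolynomial σ K) M]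

/-- The Stanley space `w K[A]`: the `K`-span of `{u • w : u a monomial in the variables of A}`. -/
noncomputable def stanleySpace (w : M) (A : Finset σ) : Submodule K M :=
  Submodule.span K { m | ∃ u : σ →₀ ℕ, (↑u.support : Set σ) ⊆ ↑A ∧
    m = (monomial u (1 : K) : MvPolynomial σ K) • w }

/-- `(w, A)` indexed by `Fin r` gives a Stanley decomposition of `M`:
each Stanley space `wᵢ K[Aᵢ]` is a free `K[Aᵢ]`-module and `M` is their internal direct
sum as a `K`-vector space. -/
def IsStanleyDecomp {r : ℕ} (w : Fin r → M) (A : Fin r → Finset σ) : Prop :=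
  (∀ i (f : MvPolynomial σ K), (↑f.vars : Set σ) ⊆ ↑(A i) → f • w i = 0 → f = 0) ∧
  (iSupIndep fun i => stanleySpace K σ M (w i) (A i)) ∧
  (⨆ i, stanleySpace K σ M (w i) (A i)) = ⊤

/-- The Stanley depth of `M`: the largest value of `minᵢ |Aᵢ|` over all Stanley
decompositions of `M`. -/
noncomputable def sdepth : ℕ :=
  sSup { d | ∃ r, ∃ w : Fin r → M, ∃ A : Fin r → Finset σ,
    IsStanleyDecomp K σ M w A ∧ d = sInf (Set.range fun i => (A i).card) }

/-- The depth of `M` with respect to the maximal graded ideal `(x₁, …, x_N)`: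
the maximal length of an `M`-regular sequence of elements of that ideal. -/
noncomputable def rdepth : ℕ :=
  sSup { d | ∃ rs : List (MvPolynomial σ K), rs.length = d ∧
    (∀ f ∈ rs, f ∈ Ideal.span (Set.range (X : σ → MvPolynomial σ K))) ∧
    RingTheory.Sequence.IsRegular M rs }

end Defs

/-- Adjacency in the strong product `Pₙ ⊠ Pₘ` (vertices `(i,j)`, `0`-indexed): distinct
vertices are adjacent iff both coordinates differ by at most `1`. -/
def pAdj (n m : ℕ) (a b : Fin n × Fin m) : Prop :=
  a ≠ b ∧ |((a.1 : ℤ) - (b.1 : ℤ))| ≤ 1 ∧ |((a.2 : ℤ) - (b.2 : ℤ))| ≤ 1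

/-- Adjacency in the strong product `Cₙ ⊠ Pₘ` (vertices `(i,j)`, `0`-indexed). -/
def cAdj (n m : ℕ) (a b : Fin n × Fin m) : Prop :=
  a ≠ b ∧ min ((a.1 : ℤ) - (b.1 : ℤ)).natAbs (n - ((a.1 : ℤ) - (b.1 : ℤ)).natAbs) ≤ 1 ∧
    |((a.2 : ℤ) - (b.2 : ℤ))| ≤ 1

/-- The edge ideal of the graph with vertex set `V` and adjacency relation `Adj`. -/
noncomputable def edgeIdeal (K : Type) [Field K] {V : Type} (Adj : V → V → Prop) :
    Ideal (MvPolynomial V K) :=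
  Ideal.span { p | ∃ a b : V, Adj a b ∧ p = X a * X b }

/-- Interval partition of the family `P` of finsets, given through lower and upper maps. -/
def IsPart {σ : Type} (P : Finset σ → Prop) (d : ℕ) (lo hi : Finset σ → Finset σ) : Prop :=
  ∀ s, P s → lo s ⊆ s ∧ s ⊆ hi s ∧ d ≤ (hi s).card ∧
    ∀ t, lo s ⊆ t → t ⊆ hi s → P t ∧ lo t = lo s ∧ hi t = hi s

def IPart {σ : Type} (P : Finset σ → Prop) (d : ℕ) : Prop := ∃ lo hi, IsPart P d lo hi

lemma IPart.mono {σ : Type} {P : Finset σ → Prop} {d d' : ℕ} (h : IPart P d) (hd : d' ≤ d) :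
    IPart P d' := by
  obtain ⟨lo, hi, h⟩ := h
  exact ⟨lo, hi, fun s hs => ⟨(h s hs).1, (h s hs).2.1, hd.trans (h s hs).2.2.1, (h s hs).2.2.2⟩⟩

lemma IPart.union {σ ι : Type} {P : Finset σ → Prop} {d : ℕ} (Q : ι → Finset σ → Prop)
    (hP : ∀ s, P s ↔ ∃ i, Q i s) (hd : ∀ i j s, Q i s → Q j s → i = j)
    (hQ : ∀ i, IPart (Q i) d) : IPart P d := by
  classical
  choose lo hi h using hQ
  refine ⟨fun s => if h : ∃ i, Q i s then lo h.choose s else ∅,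
    fun s => if h : ∃ i, Q i s then hi h.choose s else ∅, ?_⟩
  have key : ∀ i s (hs : Q i s) (h : ∃ i, Q i s), h.choose = i :=
    fun i s hs h => hd _ _ s h.choose_spec hs
  intro s hs
  obtain ⟨i, hi'⟩ := (hP s).1 hs
  have hex : ∃ i, Q i s := ⟨i, hi'⟩
  simp only [dif_pos hex, key i s hi' hex]
  obtain ⟨h1, h2, h3, h4⟩ := h i s hi'
  refine ⟨h1, h2, h3, fun t ht1 ht2 => ?_⟩
  obtain ⟨q, e1, e2⟩ := h4 t ht1 ht2
  have hex' : ∃ i, Q i t := ⟨i, q⟩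
  simp only [dif_pos hex', key i t q hex']
  exact ⟨(hP t).2 hex', e1, e2⟩

lemma IPart.cons {σ : Type} [DecidableEq σ] {P : Finset σ → Prop} {d : ℕ} (x : σ)
    (hx : ∀ s, P s → x ∉ s) (h : IPart P d) :
    IPart (fun s => x ∈ s ∧ P (s.erase x)) (d + 1) := by
  obtain ⟨lo, hi, h⟩ := h
  refine ⟨fun s => insert x (lo (s.erase x)), fun s => insert x (hi (s.erase x)), ?_⟩
  rintro s ⟨hxs, hs⟩
  obtain ⟨h1, h2, h3, h4⟩ := h _ hs
  have hxh : x ∉ hi (s.erase x) := hx _ (h4 _ (h1.trans h2) subset_rfl).1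
  refine ⟨?_, ?_, ?_, ?_⟩
  · exact Finset.insert_subset hxs (h1.trans (Finset.erase_subset _ _))
  · exact Finset.subset_insert_iff.2 h2
  · rw [Finset.card_insert_of_notMem hxh]; omega
  · intro t ht1 ht2
    have hxl : x ∉ lo (s.erase x) := fun hh => hxh (h2 (h1 hh))
    obtain ⟨q, e1, e2⟩ := h4 (t.erase x)
      (fun y hy => Finset.mem_erase.2 ⟨fun e => hxl (e ▸ hy), ht1 (Finset.mem_insert_of_mem hy)⟩)
      (Finset.subset_insert_iff.1 ht2)
    exact ⟨⟨ht1 (Finset.mem_insert_self _ _), q⟩, by simp only [e1], by simp only [e2]⟩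

lemma IPart.free {σ : Type} [DecidableEq σ] {P : Finset σ → Prop} {d : ℕ} (x : σ)
    (hx : ∀ s, P s → x ∉ s) (h : IPart P d) :
    IPart (fun s => P (s.erase x)) (d + 1) := by
  obtain ⟨lo, hi, h⟩ := h
  refine ⟨fun s => (lo (s.erase x)), fun s => insert x (hi (s.erase x)), ?_⟩
  rintro s hs
  obtain ⟨h1, h2, h3, h4⟩ := h _ hs
  have hxh : x ∉ hi (s.erase x) := hx _ (h4 _ (h1.trans h2) subset_rfl).1
  refine ⟨?_, ?_, ?_, ?_⟩
  · exact (h1.trans (Finset.erase_subset _ _))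
  · exact Finset.subset_insert_iff.2 h2
  · rw [Finset.card_insert_of_notMem hxh]; omega
  · intro t ht1 ht2
    have hxl : x ∉ lo (s.erase x) := fun hh => hxh (h2 (h1 hh))
    obtain ⟨q, e1, e2⟩ := h4 (t.erase x)
      (fun y hy => Finset.mem_erase.2 ⟨fun e => hxl (e ▸ hy), ht1 hy⟩)
      (Finset.subset_insert_iff.1 ht2)
    exact ⟨q, by simp only [e1], by simp only [e2]⟩

/-- Independent sets in the columns `k ≤ i < e`. -/
def Ind (n e k : ℕ) (s : Finset (Fin n × Fin 2)) : Prop :=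
  (∀ a ∈ s, k ≤ a.1.1 ∧ a.1.1 < e) ∧
    ∀ a ∈ s, ∀ b ∈ s, a ≠ b → a.1.1 + 2 ≤ b.1.1 ∨ b.1.1 + 2 ≤ a.1.1

lemma Ind.insert {n e k k' : ℕ} {s : Finset (Fin n × Fin 2)} {x : Fin n × Fin 2}
    (h : Ind n e k' (s.erase x)) (hk : k ≤ x.1.1) (he : x.1.1 < e) (hk' : x.1.1 + 2 ≤ k') :
    Ind n e k s := by
  have hs : ∀ a ∈ s, a = x ∨ (a ∈ s.erase x ∧ k' ≤ a.1.1 ∧ a.1.1 < e) := by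
    intro a ha
    by_cases hax : a = x
    · exact Or.inl hax
    · have := Finset.mem_erase.2 ⟨hax, ha⟩
      exact Or.inr ⟨this, h.1 a this⟩
  refine ⟨fun a ha => ?_, fun a ha b hb hab => ?_⟩
  · rcases hs a ha with rfl | ⟨-, h1, h2⟩
    · exact ⟨hk, he⟩
    · exact ⟨by omega, h2⟩
  · rcases hs a ha with rfl | ⟨ha', h1, h2⟩ <;> rcases hs b hb with rfl | ⟨hb', h3, h4⟩
    · exact absurd rfl hab
    · left; omega
    · right; omega
    · exact h.2 a ha' b hb' hab

lemma Ind.erase {n e k k' : ℕ} {s : Finset (Fin n × Fin 2)} {x : Fin n × Fin 2}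
    (h : Ind n e k s) (hx : ∀ a ∈ s, a ≠ x → k' ≤ a.1.1) :
    Ind n e k' (s.erase x) := by
  refine ⟨fun a ha => ?_, fun a ha b hb hab => ?_⟩
  · rw [Finset.mem_erase] at ha
    exact ⟨hx a ha.2 ha.1, (h.1 a ha.2).2⟩
  · exact h.2 a (Finset.mem_of_mem_erase ha) b (Finset.mem_of_mem_erase hb) hab

lemma pair_eq {n : ℕ} (a : Fin n × Fin 2) {i : ℕ} (hi : i < n) (h : a.1.1 = i) :
    a = (⟨i, hi⟩, 0) ∨ a = (⟨i, hi⟩, 1) := by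
  obtain ⟨⟨p, hp⟩, q⟩ := a
  simp only at h
  subst h
  fin_cases q <;> simp

lemma part_ind (n e : ℕ) (he : e ≤ n) : ∀ N k : ℕ, e - k ≤ N →
    IPart (Ind n e k) ((e - k + 2) / 3) := by
  intro N
  induction N with
  | zero =>
    intro k hk
    refine ⟨fun _ => ∅, fun _ => ∅, fun s hs => ?_⟩
    have : s = ∅ := by
      rw [Finset.eq_empty_iff_forall_notMem]
      intro a ha
      have := hs.1 a ha
      omega
    subst this
    refine ⟨subset_rfl, subset_rfl, ?_, fun t _ ht => ?_⟩
    · have : (e - k + 2) / 3 = 0 := by omega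
      rw [this]; exact Nat.zero_le _
    · rw [Finset.subset_empty] at ht
      subst ht
      exact ⟨hs, rfl, rfl⟩
  | succ N ih =>
    intro k hk
    by_cases hke : e ≤ k
    · exact ih k (by omega)
    have hkn : k < n := by omega
    have hx : ∀ (k' : ℕ) (x : Fin n × Fin 2), x.1.1 < k' → ∀ s, Ind n e k' s → x ∉ s := by
      intro k' x hxk s hs hxs
      have := hs.1 x hxs
      omega
    -- the base pieces
    have p1 : IPart (fun s => (⟨k, hkn⟩, 1) ∈ s ∧ Ind n e (k+2) (s.erase (⟨k, hkn⟩, 1)))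
        ((e - k + 2) / 3) :=
      (IPart.cons _ (hx _ _ (by simp)) (ih (k+2) (by omega))).mono (by omega)
    have p0 : IPart (fun s => Ind n e (k+2) (s.erase (⟨k, hkn⟩, 0)))
        ((e - k + 2) / 3) :=
      (IPart.free _ (hx _ _ (by simp)) (ih (k+2) (by omega))).mono (by omega)
    have pq : ∀ (h : k + 1 < e) (j : Fin 2), IPart (fun s => (⟨k+1, by omega⟩, j) ∈ s ∧
        Ind n e (k+3) (s.erase (⟨k+1, by omega⟩, j))) ((e - k + 2) / 3) := fun h j =>
      (IPart.cons _ (hx _ _ (by simp)) (ih (k+3) (by omega))).mono (by omega)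
    let Q : (Bool ⊕ {j : Fin 2 // k + 1 < e}) → Finset (Fin n × Fin 2) → Prop := fun i s =>
      match i with
      | Sum.inl true => (⟨k, hkn⟩, 1) ∈ s ∧ Ind n e (k+2) (s.erase (⟨k, hkn⟩, 1))
      | Sum.inl false => Ind n e (k+2) (s.erase (⟨k, hkn⟩, 0))
      | Sum.inr ⟨j, h⟩ => (⟨k+1, by omega⟩, j) ∈ s ∧
        Ind n e (k+3) (s.erase (⟨k+1, by omega⟩, j))
    have hcl : ∀ (k' : ℕ) (x y : Fin n × Fin 2) (s : Finset (Fin n × Fin 2)),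
        Ind n e k' (s.erase x) → y ∈ s → y ≠ x → k' ≤ y.1.1 := fun k' x y s h hy hyx =>
      (h.1 y (Finset.mem_erase.2 ⟨hyx, hy⟩)).1
    refine IPart.union Q ?_ ?_ ?_
    · intro s
      constructor
      · intro hs
        by_cases h1 : ∃ a ∈ s, a.1.1 = k + 1
        · obtain ⟨⟨⟨p, hp⟩, j⟩, ha, hak⟩ := h1
          simp only at hak
          subst hak
          have hlt := (hs.1 _ ha).2
          refine ⟨Sum.inr ⟨j, hlt⟩, ha, hs.erase fun b hb hbx => ?_⟩
          have h2 := hs.2 b hb _ ha hbx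
          have h3 := hs.1 b hb
          simp only at h2
          omega
        · push Not at h1
          by_cases h2 : (⟨k, hkn⟩, 1) ∈ s
          · refine ⟨Sum.inl true, h2, hs.erase fun b hb hbx => ?_⟩
            have h4 := hs.2 b hb _ h2 hbx
            have h3 := hs.1 b hb
            simp only at h4
            omega
          · refine ⟨Sum.inl false, hs.erase fun b hb hbx => ?_⟩
            have h3 := hs.1 b hb
            have h4 := h1 b hb
            have h5 : b.1.1 ≠ k := by
              intro h
              rcases pair_eq b hkn h with rfl | rfl
              · exact hbx rfl
              · exact h2 hb
            omega
      · rintro ⟨(_ | _) | ⟨j, h⟩, hq⟩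
        · exact Ind.insert (x := (⟨k, hkn⟩, 0)) hq (le_refl _) (by simp only; omega) (le_refl _)
        · exact Ind.insert (x := (⟨k, hkn⟩, 1)) hq.2 (le_refl _) (by simp only; omega) (le_refl _)
        · exact Ind.insert (x := (⟨k+1, by omega⟩, j)) hq.2 (by simp) h (le_refl _)
    · rintro ((_ | _) | ⟨j, h⟩) ((_ | _) | ⟨j', h'⟩) s hs hs'
      · rfl
      · have := hcl _ _ _ _ hs hs'.1 (by simp)
        simp at this
      · have := hcl _ _ _ _ hs hs'.1 (by simp)
        simp at this
      · have := hcl _ _ _ _ hs' hs.1 (by simp)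
        simp at this
      · rfl
      · have := hcl _ _ _ _ hs.2 hs'.1 (by simp)
        simp at this
      · have := hcl _ _ _ _ hs' hs.1 (by simp)
        simp at this
      · have := hcl _ _ _ _ hs'.2 hs.1 (by simp)
        simp at this
      · by_cases hjj : j = j'
        · subst hjj; rfl
        · have := hcl _ _ _ _ hs.2 hs'.1 (by simpa using fun h => hjj h.symm)
          simp at this
    · rintro ((_ | _) | ⟨j, h⟩)
      · exact p0
      · exact p1
      · exact pq h j

def MonP (n : ℕ) (s : Finset (Fin n × Fin 2)) : Prop := ∃ a b, a ∈ s ∧ b ∈ s ∧ pAdj n 2 a b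

def MonC (n : ℕ) (s : Finset (Fin n × Fin 2)) : Prop :=
  (∃ a b, a ∈ s ∧ b ∈ s ∧ cAdj n 2 a b) ∧ ¬ MonP n s

lemma pAdj_iff {n : ℕ} (a b : Fin n × Fin 2) : pAdj n 2 a b ↔
    a ≠ b ∧ ¬ (a.1.1 + 2 ≤ b.1.1 ∨ b.1.1 + 2 ≤ a.1.1) := by
  unfold pAdj
  have h1 := a.2.2
  have h2 := b.2.2
  simp only [abs_le]
  refine and_congr_right fun _ => ?_
  omega

lemma cAdj_iff {n : ℕ} (a b : Fin n × Fin 2) : cAdj n 2 a b ↔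
    a ≠ b ∧ (¬ (a.1.1 + 2 ≤ b.1.1 ∨ b.1.1 + 2 ≤ a.1.1) ∨ a.1.1 + 1 = b.1.1 + n ∨
      b.1.1 + 1 = a.1.1 + n) := by
  unfold cAdj
  have h1 := a.2.2
  have h2 := b.2.2
  have h3 := a.1.2
  have h4 := b.1.2
  simp only [abs_le]
  refine and_congr_right fun _ => ?_
  omega

lemma monC_iff (n : ℕ) (hn : 3 ≤ n) (s : Finset (Fin n × Fin 2)) : MonC n s ↔
    ∃ p : Fin 2 × Fin 2, (⟨0, by omega⟩, p.1) ∈ s ∧ ((⟨n-1, by omega⟩, p.2) ∈ s.erase (⟨0, by omega⟩, p.1)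
      ∧ Ind n (n-2) 2 ((s.erase (⟨0, by omega⟩, p.1)).erase (⟨n-1, by omega⟩, p.2))) := by
  have hP : ¬ MonP n s ↔
      ∀ a ∈ s, ∀ b ∈ s, a ≠ b → a.1.1 + 2 ≤ b.1.1 ∨ b.1.1 + 2 ≤ a.1.1 := by
    unfold MonP
    simp only [pAdj_iff]
    push Not
    constructor
    · intro h a ha b hb; exact h a b ha hb
    · intro h a b ha hb; exact h a ha b hb
  unfold MonC
  rw [hP]
  constructor
  · rintro ⟨⟨a, b, ha, hb, hab⟩, hs⟩
    rw [cAdj_iff] at hab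
    have main : ∀ a b : Fin n × Fin 2, a ∈ s → b ∈ s → a.1.1 + 1 = b.1.1 + n →
        ∃ p : Fin 2 × Fin 2, (⟨0, by omega⟩, p.1) ∈ s ∧ ((⟨n-1, by omega⟩, p.2) ∈ s.erase (⟨0, by omega⟩, p.1)
      ∧ Ind n (n-2) 2 ((s.erase (⟨0, by omega⟩, p.1)).erase (⟨n-1, by omega⟩, p.2))) := by
      rintro ⟨⟨a, ha'⟩, j⟩ ⟨⟨b, hb'⟩, l⟩ ha hb hab
      simp only at hab
      obtain rfl : b = 0 := by omega
      obtain rfl : a = n - 1 := by omega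
      refine ⟨(l, j), hb, Finset.mem_erase.2 ⟨by simp; omega, ha⟩, ?_, ?_⟩
      · intro c hc
        simp only [Finset.mem_erase] at hc
        have h1 := hs c hc.2.2 _ ha hc.1
        have h2 := hs c hc.2.2 _ hb hc.2.1
        have := c.1.2
        simp only at h1 h2
        omega
      · intro c hc d hd
        simp only [Finset.mem_erase] at hc hd
        exact hs c hc.2.2 d hd.2.2
    rcases hab with ⟨hne, h | h | h⟩
    · exact absurd (hs a ha b hb hne) h
    · exact main a b ha hb h
    · exact main b a hb ha h
  · rintro ⟨⟨l, j⟩, h0, h1, hI⟩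
    have h1' := Finset.mem_of_mem_erase h1
    refine ⟨⟨_, _, h1', h0, ?_⟩, ?_⟩
    · rw [cAdj_iff]
      refine ⟨?_, Or.inr (Or.inl ?_)⟩
      · simp; omega
      · simp only; omega
    · have hs : ∀ a ∈ s, a = (⟨0, by omega⟩, l) ∨ a = (⟨n-1, by omega⟩, j) ∨
          (a ∈ (s.erase (⟨0, by omega⟩, l)).erase (⟨n-1, by omega⟩, j) ∧ 2 ≤ a.1.1 ∧ a.1.1 < n - 2) := by
        intro a ha
        by_cases e1 : a = (⟨0, by omega⟩, l)
        · exact Or.inl e1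
        by_cases e2 : a = (⟨n-1, by omega⟩, j)
        · exact Or.inr (Or.inl e2)
        have := Finset.mem_erase.2 ⟨e2, Finset.mem_erase.2 ⟨e1, ha⟩⟩
        exact Or.inr (Or.inr ⟨this, hI.1 a this⟩)
      intro a ha b hb hab
      rcases hs a ha with rfl | rfl | ⟨ha', h3, h4⟩ <;>
      rcases hs b hb with rfl | rfl | ⟨hb', h5, h6⟩
      · exact absurd rfl hab
      · simp only; omega
      · simp only; omega
      · simp only; omega
      · exact absurd rfl hab
      · simp only; omega
      · simp only; omega
      · simp only; omega
      · exact hI.2 a ha' b hb' hab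

lemma part_top (n : ℕ) (hn : 3 ≤ n) : IPart (MonC n) ((n + 4) / 3) := by
  refine IPart.union (ι := Fin 2 × Fin 2) _ (monC_iff n hn) ?_ ?_
  · rintro ⟨l, j⟩ ⟨l', j'⟩ s ⟨h0, h1, hI⟩ ⟨h0', h1', hI'⟩
    have h1 := Finset.mem_of_mem_erase h1
    have h1' := Finset.mem_of_mem_erase h1'
    have e1 : l' = l := by
      by_contra hne
      have := (hI.1 (⟨0, by omega⟩, l') (by
        simp only [Finset.mem_erase]
        refine ⟨by simp; omega, by simpa using hne, h0'⟩)).1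
      simp at this
    have e2 : j' = j := by
      by_contra hne
      have := (hI.1 (⟨n-1, by omega⟩, j') (by
        simp only [Finset.mem_erase]
        refine ⟨by simpa using hne, by simp; omega, h1'⟩)).2
      simp only at this
      omega
    rw [e1, e2]
  · rintro ⟨l, j⟩
    have h := part_ind n (n-2) (by omega) _ 2 le_rfl
    have h2 := IPart.cons (⟨n-1, by omega⟩, j) (fun s hs hx => by
      have := (hs.1 _ hx).2
      simp only at this
      omega) h
    have hn0 : 0 < n := by omega
    have hn1 : n - 1 < n := by omega
    have hxy : ((⟨0, hn0⟩, l) : Fin n × Fin 2) ≠ (⟨n-1, hn1⟩, j) := by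
      simp only [ne_eq, Prod.mk.injEq, Fin.mk.injEq, not_and]
      omega
    have h3 := IPart.cons (⟨0, hn0⟩, l) (fun s hs hx => by
      have := (hs.2.1 _ (Finset.mem_erase.2 ⟨hxy, hx⟩)).1
      simp only at this
      omega) h2
    exact h3.mono (by omega)

lemma mem_edge (K : Type) [Field K] {V : Type} (Adj : V → V → Prop) (hA : ∀ a b, Adj a b → a ≠ b)
    (f : MvPolynomial V K) : f ∈ edgeIdeal K Adj ↔
      ∀ u ∈ f.support, ∃ a b, a ∈ u.support ∧ b ∈ u.support ∧ Adj a b := by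
  classical
  have : edgeIdeal K Adj = Ideal.span ((fun s => monomial s (1 : K)) ''
      {u | ∃ a b, Adj a b ∧ u = Finsupp.single a 1 + Finsupp.single b 1}) := by
    unfold edgeIdeal
    congr 1
    ext p
    constructor
    · rintro ⟨a, b, h, rfl⟩
      exact ⟨_, ⟨a, b, h, rfl⟩, by simp [X, monomial_mul]⟩
    · rintro ⟨_, ⟨a, b, h, rfl⟩, rfl⟩
      exact ⟨a, b, h, by simp [X, monomial_mul]⟩
  rw [this, mem_ideal_span_monomial_image]
  refine forall₂_congr fun u _ => ?_
  constructor
  · rintro ⟨_, ⟨a, b, h, rfl⟩, hle⟩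
    refine ⟨a, b, ?_, ?_, h⟩
    · have := hle a
      simp at this ⊢
      omega
    · have := hle b
      simp at this ⊢
      omega
  · rintro ⟨a, b, ha, hb, h⟩
    refine ⟨_, ⟨a, b, h, rfl⟩, fun c => ?_⟩
    have hne := hA a b h
    simp only [Finsupp.mem_support_iff] at ha hb
    simp only [Finsupp.add_apply, Finsupp.single_apply]
    split_ifs with h1 h2 h2
    · exact absurd (h1.trans h2.symm) hne
    · subst h1; omega
    · subst h2; omega
    · omega

lemma sdepth_ge (K : Type) [Field K] (σ : Type) [Fintype σ] [DecidableEq σ]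
    (M : Type) [AddCommGroup M] [Module K M] [Module (MvPolynomial σ K) M]
    [IsScalarTower K (MvPolynomial σ K) M] (B : Set (σ →₀ ℕ)) (b : B → M)
    (hli : LinearIndependent K b) (hsp : Submodule.span K (Set.range b) = ⊤)
    (hmul : ∀ (u : B) (v : σ →₀ ℕ) (h : u.1 + v ∈ B),
      (monomial v (1 : K) : MvPolynomial σ K) • b u = b ⟨u.1 + v, h⟩)
    (P : Finset σ → Prop) (hB : ∀ u, u ∈ B ↔ P u.support) (d : ℕ) (lo hi : Finset σ → Finset σ)
    (h : IsPart P d lo hi) (hne : ∃ s, P s) : sdepth K σ M ≥ d := by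
  classical
  let T : Finset (Finset σ × Finset σ) :=
    (Finset.univ.filter P).image (fun s => (lo s, hi s))
  let F : Fin T.card → Finset σ := fun i => (T.equivFin.symm i).1.1
  let G : Fin T.card → Finset σ := fun i => (T.equivFin.symm i).1.2
  have hT : ∀ i, ∃ s, P s ∧ F i = lo s ∧ G i = hi s := by
    intro i
    obtain ⟨s, hs, e⟩ := Finset.mem_image.1 (T.equivFin.symm i).2
    refine ⟨s, (Finset.mem_filter.1 hs).2, ?_, ?_⟩
    · simp only [F, ← e]
    · simp only [G, ← e]
  have hex : ∀ s, P s → ∃ i, F i = lo s ∧ G i = hi s := by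
    intro s hs
    refine ⟨T.equivFin ⟨(lo s, hi s), Finset.mem_image.2 ⟨s, by simpa using hs, rfl⟩⟩, ?_, ?_⟩
    · simp [F]
    · simp [G]
  have hbet : ∀ i t, F i ⊆ t → t ⊆ G i → P t ∧ lo t = F i ∧ hi t = G i := by
    intro i t h1 h2
    obtain ⟨s, hs, e1, e2⟩ := hT i
    rw [e1] at h1 ⊢
    rw [e2] at h2 ⊢
    exact (h s hs).2.2.2 t h1 h2
  have hFG : ∀ i, F i ⊆ G i := by
    intro i
    obtain ⟨s, hs, e1, e2⟩ := hT i
    rw [e1, e2]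
    exact (h s hs).1.trans (h s hs).2.1
  have hinj : ∀ i j, F i = F j → G i = G j → i = j := by
    intro i j e1 e2
    exact T.equivFin.symm.injective (Subtype.ext (Prod.ext e1 e2))
  let ind : Finset σ → (σ →₀ ℕ) := fun s => Finsupp.indicator s (fun _ _ => 1)
  have hind : ∀ s a, ind s a = if a ∈ s then 1 else 0 := by
    intro s a
    simp [ind, Finsupp.indicator_apply]
  have hsupp : ∀ s (v : σ →₀ ℕ), (ind s + v).support = s ∪ v.support := by
    intro s v
    ext a
    simp only [Finsupp.mem_support_iff, Finsupp.add_apply, hind, Finset.mem_union]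
    split_ifs with ha <;> simp [ha]
  have hinB : ∀ i (v : σ →₀ ℕ), v.support ⊆ G i → ind (F i) + v ∈ B := by
    intro i v hv
    rw [hB, hsupp]
    exact (hbet i _ Finset.subset_union_left (Finset.union_subset (hFG i) hv)).1
  have hinB0 : ∀ i, ind (F i) ∈ B := by
    intro i
    have := hinB i 0 (by simp)
    rwa [add_zero] at this
  let w : Fin T.card → M := fun i => b ⟨ind (F i), hinB0 i⟩
  let I : Fin T.card → Set B := fun i => {u | F i ⊆ u.1.support ∧ u.1.support ⊆ G i}
  have hS : ∀ i, stanleySpace K σ M (w i) (G i) = Submodule.span K (b '' I i) := by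
    intro i
    unfold stanleySpace
    congr 1
    ext m
    constructor
    · rintro ⟨v, hv, rfl⟩
      have hv' : v.support ⊆ G i := by exact_mod_cast hv
      refine ⟨⟨_, hinB i v hv'⟩, ?_, (hmul ⟨ind (F i), hinB0 i⟩ v (hinB i v hv')).symm⟩
      simp only [I, Set.mem_ofPred_eq, hsupp]
      exact ⟨Finset.subset_union_left, Finset.union_subset (hFG i) hv'⟩
    · rintro ⟨⟨u, hu⟩, ⟨h1, h2⟩, rfl⟩
      have e : ind (F i) + (u - ind (F i)) = u := by
        apply add_tsub_cancel_of_le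
        intro a
        rw [hind]
        split_ifs with ha
        · exact Nat.one_le_iff_ne_zero.2 (Finsupp.mem_support_iff.1 (h1 ha))
        · exact Nat.zero_le _
      refine ⟨u - ind (F i), ?_, ?_⟩
      · have : (u - ind (F i)).support ⊆ u.support := Finsupp.support_tsub
        exact_mod_cast this.trans h2
      · rw [hmul ⟨ind (F i), hinB0 i⟩ _ (by rw [e]; exact hu)]
        congr 1
        exact Subtype.ext e.symm
  have hdec : IsStanleyDecomp K σ M w G := by
    refine ⟨?_, ?_, ?_⟩
    · intro i f hf h0
      have hfs : ∀ v ∈ f.support, v.support ⊆ G i := by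
        intro v hv a ha
        exact_mod_cast hf (by
          rw [Finset.mem_coe, mem_vars_iff_mem_support]
          exact ⟨v, hv, ha⟩)
      let g : {v : σ →₀ ℕ // v.support ⊆ G i} → B := fun v => ⟨ind (F i) + v.1, hinB i v.1 v.2⟩
      have hg : Function.Injective g := by
        intro v v' e
        exact Subtype.ext (add_left_cancel (congrArg Subtype.val e))
      have hl := linearIndependent_iff'.1 (hli.comp g hg)
        (f.support.subtype _) (fun v => coeff v.1 f) (by
          rw [← h0]
          conv_rhs => rw [f.as_sum, Finset.sum_smul]
          rw [← Finset.sum_subtype_of_mem (p := fun v : σ →₀ ℕ => v.support ⊆ G i) _ hfs]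
          refine Finset.sum_congr rfl fun v _ => ?_
          have : (monomial v.1 (coeff v.1 f) : MvPolynomial σ K) =
              coeff v.1 f • monomial v.1 (1:K) := by simp [smul_monomial]
          rw [this, smul_assoc]
          congr 1
          exact (hmul ⟨ind (F i), hinB0 i⟩ v.1 (hinB i v.1 v.2)).symm)
      ext v
      rw [coeff_zero]
      by_contra hv
      have hv' : v ∈ f.support := mem_support_iff.2 hv
      exact hv (hl ⟨v, hfs v hv'⟩ (by simpa using hv))
    · rw [iSupIndep_def]
      intro i
      rw [hS]
      refine (hli.disjoint_span_image (s := I i) (t := (I i)ᶜ) disjoint_compl_right).mono_right ?_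
      refine iSup₂_le fun j hj => ?_
      rw [hS]
      refine Submodule.span_mono (Set.image_mono fun u hu hu' => hj ?_)
      have a1 := hbet _ _ hu.1 hu.2
      have a2 := hbet _ _ hu'.1 hu'.2
      exact hinj _ _ (a1.2.1.symm.trans a2.2.1) (a1.2.2.symm.trans a2.2.2)
    · rw [eq_top_iff, ← hsp, Submodule.span_le]
      rintro _ ⟨u, rfl⟩
      have hu := (hB u.1).1 u.2
      obtain ⟨i, e1, e2⟩ := hex _ hu
      refine Submodule.mem_iSup_of_mem i ?_
      rw [hS]
      refine Submodule.subset_span ⟨u, ⟨?_, ?_⟩, rfl⟩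
      · rw [e1]; exact (h _ hu).1
      · rw [e2]; exact (h _ hu).2.1
  obtain ⟨s, hs⟩ := hne
  obtain ⟨i0, -⟩ := hex s hs
  have hd : d ≤ sInf (Set.range fun i => (G i).card) := by
    refine le_csInf ⟨_, i0, rfl⟩ ?_
    rintro _ ⟨i, rfl⟩
    obtain ⟨s, hs, -, e⟩ := hT i
    simp only [e]
    exact (h s hs).2.2.1
  refine hd.trans (le_csSup ⟨Fintype.card σ, ?_⟩ ⟨_, w, G, hdec, rfl⟩)
  rintro _ ⟨r, w', A, -, rfl⟩
  rcases Nat.eq_zero_or_pos r with rfl | hr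
  · simp
  · exact (Nat.sInf_le (Set.mem_range_self (⟨0, hr⟩ : Fin r))).trans (Finset.card_le_univ _)

/-- For every integer `n ≥ 3`, `sdepth(I(C_{n,2})/I(P_{n,2})) ≥ ⌈(n+2)/3⌉`. -/
theorem sdepth_edgeIdeal_C_quot_P_n_2 (K : Type) [Field K] (n : ℕ) (hn : 3 ≤ n) :
    sdepth K (Fin n × Fin 2)
        (↥(edgeIdeal K (cAdj n 2)) ⧸
          Submodule.comap (edgeIdeal K (cAdj n 2)).subtype (edgeIdeal K (pAdj n 2))) ≥
      (n + 4) / 3 := by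
  
  classical
  have hT := part_top n hn
  obtain ⟨lo, hi, h⟩ := hT
  refine sdepth_ge K _ _ {u : (Fin n × Fin 2) →₀ ℕ | MonC n u.support}
    (fun u => Submodule.Quotient.mk ⟨monomial u.1 1, (mem_edge K _ (fun a b h => h.1) _).2 (by
      intro v hv
      rw [support_monomial, if_neg one_ne_zero, Finset.mem_singleton] at hv
      subst hv
      exact u.2.1)⟩) ?_ ?_ ?_ (MonC n) (fun u => Iff.rfl) _ lo hi h ?_
  · rw [linearIndependent_iff']
    intro t g hg i hi
    by_contra hne
    have key : (∑ x ∈ t, g x • (monomial x.1 (1:K) : MvPolynomial (Fin n × Fin 2) K)) ∈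
        edgeIdeal K (pAdj n 2) := by
      have : (Submodule.Quotient.mk (∑ x ∈ t, g x • (⟨monomial x.1 1,
          (mem_edge K _ (fun a b h => h.1) _).2 (by
      intro v hv
      rw [support_monomial, if_neg one_ne_zero, Finset.mem_singleton] at hv
      subst hv
      exact x.2.1)⟩ : ↥(edgeIdeal K (cAdj n 2)))) : (↥(edgeIdeal K (cAdj n 2)) ⧸
          Submodule.comap (edgeIdeal K (cAdj n 2)).subtype (edgeIdeal K (pAdj n 2)))) = 0 := by
        rw [← hg]
        exact map_sum ((Submodule.mkQ (Submodule.comap (edgeIdeal K (cAdj n 2)).subtype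
          (edgeIdeal K (pAdj n 2)))).restrictScalars K) _ _
      rw [Submodule.Quotient.mk_eq_zero, Submodule.mem_comap] at this
      convert this using 1
      simp
    rw [mem_edge K _ (fun a b h => h.1)] at key
    refine i.2.2 (key i.1 ?_)
    rw [mem_support_iff, coeff_sum]
    simp only [coeff_smul, coeff_monomial, smul_eq_mul, mul_ite, mul_one, mul_zero]
    rw [Finset.sum_eq_single i]
    · simpa using hne
    · intro c _ hc
      rw [if_neg (fun h => hc (Subtype.ext h))]
    · intro h; exact absurd hi h
  · rw [eq_top_iff]
    rintro q -
    obtain ⟨⟨f, hf⟩, rfl⟩ := Submodule.Quotient.mk_surjective _ q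
    have hf' := (mem_edge K _ (fun a b h => h.1) _).1 hf
    have hm : ∀ v ∈ f.support, monomial v (coeff v f) ∈ edgeIdeal K (cAdj n 2) := by
      intro v hv
      rw [mem_edge K _ (fun a b h => h.1)]
      intro w hw
      have := support_monomial_subset hw
      rw [Finset.mem_singleton] at this
      subst this
      exact hf' w hv
    have : (⟨f, hf⟩ : ↥(edgeIdeal K (cAdj n 2))) =
        ∑ v ∈ f.support.attach, ⟨monomial v.1 (coeff v.1 f), hm v.1 v.2⟩ := by
      apply Subtype.ext
      rw [AddSubmonoidClass.coe_finsetSum]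
      exact f.as_sum.trans (Finset.sum_attach _ _).symm
    rw [this]
    have e := map_sum ((Submodule.mkQ (Submodule.comap (edgeIdeal K (cAdj n 2)).subtype
          (edgeIdeal K (pAdj n 2))))) (fun v : f.support => (⟨monomial v.1 (coeff v.1 f), hm v.1 v.2⟩ : ↥(edgeIdeal K (cAdj n 2)))) f.support.attach
    simp only [Submodule.mkQ_apply] at e
    rw [e]
    refine Submodule.sum_mem _ fun v _ => ?_
    by_cases hv : MonP n v.1.support
    · convert Submodule.zero_mem _
      rw [Submodule.Quotient.mk_eq_zero, Submodule.mem_comap, Submodule.subtype_apply, mem_edge K _ (fun a b h => h.1)]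
      intro w hw
      have := support_monomial_subset hw
      rw [Finset.mem_singleton] at this
      subst this
      exact hv
    · have := Submodule.smul_mem _ (coeff v.1 f) (Submodule.subset_span (R := K) (Set.mem_range_self (f := fun u : {u : (Fin n × Fin 2) →₀ ℕ | MonC n u.support} => (Submodule.Quotient.mk ⟨monomial u.1 1, (mem_edge K _ (fun a b h => h.1) _).2 (by
      intro v hv
      rw [support_monomial, if_neg one_ne_zero, Finset.mem_singleton] at hv
      subst hv
      exact u.2.1)⟩ : (↥(edgeIdeal K (cAdj n 2)) ⧸
          Submodule.comap (edgeIdeal K (cAdj n 2)).subtype (edgeIdeal K (pAdj n 2))))) ⟨v.1, hf' v.1 v.2, hv⟩))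
      convert this using 1
      rw [← Submodule.Quotient.mk_smul]
      congr 1
      apply Subtype.ext
      simp [smul_monomial]
  · intro u v hu
    rw [← Submodule.Quotient.mk_smul]
    congr 1
    apply Subtype.ext
    simp [monomial_mul, add_comm]
  · refine ⟨{(⟨0, by omega⟩, 0), (⟨n-1, by omega⟩, 0)}, ⟨(⟨0, by omega⟩, 0), (⟨n-1, by omega⟩, 0), by simp, by simp, ?_⟩, ?_⟩
    · refine ⟨by simp; omega, ?_, by simp⟩
      have : ((((⟨0, by omega⟩ : Fin n) : ℕ) : ℤ) - (((⟨n-1, by omega⟩ : Fin n) : ℕ) : ℤ)).natAbs = n - 1 := by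
        simp only []; omega
      rw [this]; omega
    · rintro ⟨a, b, ha, hb, hab, h1, -⟩
      rw [abs_le] at h1
      simp only [Finset.mem_insert, Finset.mem_singleton] at ha hb
      rcases ha with rfl | rfl <;> rcases hb with rfl | rfl <;> simp at hab h1 <;> omega
end

section
/- For every integer n ≥ 3, sdepth(I(C_{n,3})/I(P_{n,3})) ≥ ⌈(n+2)/3⌉, where I(C_{n,3})/I(P_{n,3}) is viewed as a Z^{3n}-graded module over S_{n,3} (note I(P_{n,3}) ⊆ I(C_{n,3}), since P_{n,3} is a subgraph of C_{n,3} on the same vertex set). -/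
open MvPolynomial

section Helpers

variable {K : Type} [Field K] {V : Type}

lemma mem_edgeIdeal_iff' (Adj : V → V → Prop) (f : MvPolynomial V K) :
    f ∈ edgeIdeal K Adj ↔ ∀ u ∈ f.support, ∃ a b, Adj a b ∧
      (Finsupp.single a 1 + Finsupp.single b 1 : V →₀ ℕ) ≤ u := by
  have : ({ p | ∃ a b : V, Adj a b ∧ p = X a * X b } : Set (MvPolynomial V K)) =
      (fun s => monomial s (1 : K)) ''
        { s | ∃ a b : V, Adj a b ∧ s = Finsupp.single a 1 + Finsupp.single b 1 } := by
    ext p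
    constructor
    · rintro ⟨a, b, h, rfl⟩
      exact ⟨_, ⟨a, b, h, rfl⟩, by simp [X, monomial_mul]⟩
    · rintro ⟨_, ⟨a, b, h, rfl⟩, rfl⟩
      exact ⟨a, b, h, by simp [X, monomial_mul]⟩
  rw [edgeIdeal, this, mem_ideal_span_monomial_image]
  constructor
  · intro h u hu
    obtain ⟨_, ⟨a, b, hab, rfl⟩, h2⟩ := h u hu
    exact ⟨a, b, hab, h2⟩
  · intro h u hu
    obtain ⟨a, b, hab, h2⟩ := h u hu
    exact ⟨_, ⟨a, b, hab, rfl⟩, h2⟩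

/-- `T` contains an edge. -/
def HasEdge (Adj : V → V → Prop) (T : Finset V) : Prop :=
  ∃ a ∈ T, ∃ b ∈ T, Adj a b

lemma mem_edgeIdeal_iff {Adj : V → V → Prop} (hirr : ∀ a, ¬ Adj a a) (f : MvPolynomial V K) :
    f ∈ edgeIdeal K Adj ↔ ∀ u, coeff u f ≠ 0 → HasEdge Adj u.support := by
  rw [mem_edgeIdeal_iff']
  refine forall_congr' fun u => ?_
  rw [mem_support_iff]
  refine imp_congr_right fun _ => ?_
  constructor
  · rintro ⟨a, b, hab, hle⟩
    refine ⟨a, ?_, b, ?_, hab⟩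
    · have := hle a
      simp at this
      simp; omega
    · have := hle b
      simp at this
      simp; omega
  · rintro ⟨a, ha, b, hb, hab⟩
    refine ⟨a, b, hab, fun c => ?_⟩
    have hne : a ≠ b := by rintro rfl; exact hirr _ hab
    classical
    simp only [Finsupp.mem_support_iff] at ha hb
    simp only [Finsupp.add_apply, Finsupp.single_apply]
    split_ifs with h1 h2 h2
    · subst h1; exact absurd h2.symm hne
    · subst h1; omega
    · subst h2; omega
    · omega

variable (K) in
/-- the quotient module -/
abbrev QM (C P : V → V → Prop) : Type :=
  (↥(edgeIdeal K C) ⧸ Submodule.comap (edgeIdeal K C).subtype (edgeIdeal K P))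

variable {C P : V → V → Prop}

/-- the quotient map -/
noncomputable abbrev qmk (f : MvPolynomial V K) (hf : f ∈ edgeIdeal K C) : QM K C P :=
  Submodule.Quotient.mk ⟨f, hf⟩

lemma exists_coeff_fun (hP : ∀ a, ¬ P a a) (u : V →₀ ℕ) (hu : ¬ HasEdge P u.support) :
    ∃ c : QM K C P →ₗ[K] K, ∀ f hf, c (qmk f hf) = coeff u f := by
  let N := Submodule.comap (edgeIdeal K C).subtype (edgeIdeal K P)
  let g : ↥(edgeIdeal K C) →ₗ[K] K :=
    (lcoeff K u).comp ((edgeIdeal K C).subtype.restrictScalars K)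
  have hg : N.restrictScalars K ≤ LinearMap.ker g := by
    intro x hx
    have hx' : (x : MvPolynomial V K) ∈ edgeIdeal K P := hx
    rw [mem_edgeIdeal_iff hP] at hx'
    rw [LinearMap.mem_ker]
    by_contra h
    exact hu (hx' u h)
  refine ⟨((N.restrictScalars K).liftQ g hg).comp
    (Submodule.Quotient.restrictScalarsEquiv K N).symm.toLinearMap, ?_⟩
  intro f hf
  rfl

lemma qmk_eq_zero (hP : ∀ a, ¬ P a a) (f : MvPolynomial V K) (hf : f ∈ edgeIdeal K C) :
    (qmk f hf : QM K C P) = 0 ↔ ∀ u, coeff u f ≠ 0 → HasEdge P u.support := by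
  rw [Submodule.Quotient.mk_eq_zero, ← mem_edgeIdeal_iff hP]
  rfl

/-- exponent of the squarefree monomial with support `R` -/
noncomputable def sqf (R : Finset V) : V →₀ ℕ :=
  Finsupp.indicator R (fun _ _ => 1)

lemma sqf_support (R : Finset V) : (sqf R).support = R := by
  classical
  ext a
  simp [sqf, Finsupp.indicator_apply]

lemma sqf_le {R : Finset V} {u : V →₀ ℕ} (h : R ⊆ u.support) : sqf R ≤ u := by
  classical
  intro a
  simp only [sqf, Finsupp.indicator_apply]
  split_ifs with ha
  · have := h ha
    simp at this; omega
  · omega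

lemma support_add' [DecidableEq V] (u v : V →₀ ℕ) : (u + v).support = u.support ∪ v.support := by
  ext a
  simp
  omega

lemma HasEdge.mono {Adj : V → V → Prop} {S T : Finset V} (h : HasEdge Adj S) (hST : S ⊆ T) :
    HasEdge Adj T := by
  obtain ⟨a, ha, b, hb, hab⟩ := h
  exact ⟨a, hST ha, b, hST hb, hab⟩

lemma sqf_mem (hC : ∀ a, ¬ C a a) {R : Finset V} (h : HasEdge C R) :
    (monomial (sqf R) (1 : K)) ∈ edgeIdeal K C := by
  classical
  rw [mem_edgeIdeal_iff hC]
  intro u hu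
  rw [coeff_monomial] at hu
  split_ifs at hu with h1
  · subst h1; rwa [sqf_support]
  · simp at hu

lemma decomp (hC : ∀ a, ¬ C a a) (hP : ∀ a, ¬ P a a) {r : ℕ} (R D : Fin r → Finset V)
    (hR : ∀ i, HasEdge C (R i)) (hRD : ∀ i, R i ⊆ D i) (hD : ∀ i, ¬ HasEdge P (D i))
    (hex : ∀ T, HasEdge C T → ¬ HasEdge P T → ∃ i, R i ⊆ T ∧ T ⊆ D i)
    (huniq : ∀ T i j, R i ⊆ T → T ⊆ D i → R j ⊆ T → T ⊆ D j → i = j) :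
    IsStanleyDecomp K V (QM K C P) (fun i => qmk _ (sqf_mem hC (hR i))) D := by
  classical
  have hsmul : ∀ i (f : MvPolynomial V K), f • (qmk _ (sqf_mem hC (hR i)) : QM K C P) =
      qmk (f * monomial (sqf (R i)) 1) (Ideal.mul_mem_left _ _ (sqf_mem hC (hR i))) := by
    intro i f
    rfl
  choose c hc using fun (u : V →₀ ℕ) (hu : ¬ HasEdge P u.support) =>
    exists_coeff_fun (K := K) (C := C) hP u hu
  have hV : ∀ i u (hu : ¬ HasEdge P u.support), ¬ (R i ⊆ u.support ∧ u.support ⊆ D i) →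
      stanleySpace K V (QM K C P) (qmk _ (sqf_mem hC (hR i))) (D i) ≤ LinearMap.ker (c u hu) := by
    intro i u hu hn
    rw [stanleySpace, Submodule.span_le]
    rintro _ ⟨v, hv, rfl⟩
    rw [SetLike.mem_coe, LinearMap.mem_ker, hsmul, hc, monomial_mul, coeff_monomial, if_neg]
    rintro rfl
    apply hn
    rw [support_add', sqf_support]
    exact ⟨Finset.subset_union_right, Finset.union_subset (by exact_mod_cast hv) (hRD i)⟩
  have hzero : ∀ m : QM K C P, (∀ u hu, c u hu m = 0) → m = 0 := by
    intro m hm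
    obtain ⟨⟨f, hf⟩, rfl⟩ := Submodule.Quotient.mk_surjective _ m
    refine (qmk_eq_zero hP f hf).2 ?_
    intro u hu
    by_contra hne
    exact hu ((hc u hne f hf).symm.trans (hm u hne))
  refine ⟨?_, ?_, ?_⟩
  · intro i f hf h0
    rw [hsmul, qmk_eq_zero hP] at h0
    ext u
    rw [coeff_zero]
    by_contra hne
    have := h0 (u + sqf (R i)) (by rwa [coeff_mul_monomial, mul_one])
    rw [support_add', sqf_support] at this
    refine hD i (this.mono (Finset.union_subset ?_ (hRD i)))
    intro a ha
    have : a ∈ f.vars := by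
      rw [mem_vars_iff_mem_support]
      exact ⟨u, by rwa [mem_support_iff], ha⟩
    exact_mod_cast hf this
  · rw [iSupIndep_def]
    intro i
    rw [Submodule.disjoint_def]
    intro m hm1 hm2
    apply hzero
    intro u hu
    by_cases h : R i ⊆ u.support ∧ u.support ⊆ D i
    · have hle : (⨆ j, ⨆ (_ : j ≠ i),
          stanleySpace K V (QM K C P) (qmk _ (sqf_mem hC (hR j))) (D j)) ≤
          LinearMap.ker (c u hu) := by
        refine iSup_le fun j => iSup_le fun hj => hV j u hu ?_
        rintro ⟨h1, h2⟩
        exact hj (huniq _ _ _ h1 h2 h.1 h.2)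
      exact hle hm2
    · exact hV i u hu h hm1
  · rw [eq_top_iff]
    rintro m -
    obtain ⟨⟨f, hf⟩, rfl⟩ := Submodule.Quotient.mk_surjective _ m
    have hmem : ∀ u : f.support, monomial (u : V →₀ ℕ) (coeff u f) ∈ edgeIdeal K C := by
      intro u
      rw [mem_edgeIdeal_iff hC] at hf ⊢
      intro v hv
      rw [coeff_monomial] at hv
      split_ifs at hv with h
      · subst h; exact hf _ hv
      · simp at hv
    have hsum : (⟨f, hf⟩ : edgeIdeal K C) = ∑ u : f.support, ⟨_, hmem u⟩ := by
      apply Subtype.ext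
      rw [AddSubmonoidClass.coe_finsetSum]
      exact f.as_sum.trans (Finset.sum_coe_sort f.support (fun u => monomial u (coeff u f))).symm
    rw [hsum, ← Submodule.mkQ_apply, map_sum]
    refine Submodule.sum_mem _ fun u _ => ?_
    have hCu : HasEdge C (u : V →₀ ℕ).support :=
      (mem_edgeIdeal_iff hC f).1 hf _ (mem_support_iff.1 u.2)
    by_cases hPu : HasEdge P (u : V →₀ ℕ).support
    · have : (qmk _ (hmem u) : QM K C P) = 0 := by
        rw [qmk_eq_zero hP]
        intro v hv
        rw [coeff_monomial] at hv
        split_ifs at hv with h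
        · rwa [← h]
        · simp at hv
      exact Set.mem_of_eq_of_mem this (Submodule.zero_mem _)
    · obtain ⟨i, h1, h2⟩ := hex _ hCu hPu
      refine Submodule.mem_iSup_of_mem i ?_
      have : (qmk _ (hmem u) : QM K C P) = (coeff (u : V →₀ ℕ) f) •
          ((monomial ((u : V →₀ ℕ) - sqf (R i)) (1 : K) : MvPolynomial V K) •
            (qmk _ (sqf_mem hC (hR i)) : QM K C P)) := by
        rw [hsmul]
        refine congrArg Submodule.Quotient.mk (Subtype.ext ?_)
        change _ = coeff (u : V →₀ ℕ) f • (_ * _)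
        rw [monomial_mul, tsub_add_cancel_of_le (sqf_le h1), smul_monomial]
        simp
      refine Set.mem_of_eq_of_mem this ?_
      refine Submodule.smul_mem _ _ (Submodule.subset_span ⟨_, ?_, rfl⟩)
      intro a ha
      apply h2
      simp at ha ⊢
      omega

lemma sdepth_ge_s13 [Fintype V] (hC : ∀ a, ¬ C a a) (hP : ∀ a, ¬ P a a) {r : ℕ}
    (R D : Fin r → Finset V)
    (hR : ∀ i, HasEdge C (R i)) (hRD : ∀ i, R i ⊆ D i) (hD : ∀ i, ¬ HasEdge P (D i))
    (hex : ∀ T, HasEdge C T → ¬ HasEdge P T → ∃ i, R i ⊆ T ∧ T ⊆ D i)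
    (huniq : ∀ T i j, R i ⊆ T → T ⊆ D i → R j ⊆ T → T ⊆ D j → i = j)
    (hr : 0 < r) (d : ℕ) (hd : ∀ i, d ≤ (D i).card) :
    d ≤ sdepth K V (QM K C P) := by
  have h1 : d ≤ sInf (Set.range fun i => (D i).card) := by
    apply le_csInf
    · exact ⟨_, ⟨0, hr⟩, rfl⟩
    · rintro _ ⟨i, rfl⟩
      exact hd i
  refine h1.trans (le_csSup ?_ ⟨r, _, D, decomp hC hP R D hR hRD hD hex huniq, rfl⟩)
  refine ⟨Fintype.card V, ?_⟩
  rintro _ ⟨r', w, A, -, rfl⟩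
  rcases Nat.eq_zero_or_pos r' with h | h
  · subst h
    simp
  · exact (Nat.sInf_le (Set.mem_range_self (⟨0, h⟩ : Fin r'))).trans (Finset.card_le_univ _)

end Helpers

section Strip

/-- The vertices that are toggled. -/
def hub (n : ℕ) (v : Fin n × Fin 3) : Prop :=
  v.2 = 1 ∧ (v.1 : ℕ) % 3 = 2 ∧ (v.1 : ℕ) + 3 ≤ n

lemma pAdj_symm {n m : ℕ} {a b : Fin n × Fin m} (h : pAdj n m a b) : pAdj n m b a := by
  obtain ⟨h1, h2, h3⟩ := h
  exact ⟨h1.symm, by rwa [abs_sub_comm], by rwa [abs_sub_comm]⟩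

lemma cAdj_not_pAdj {n : ℕ} {a b : Fin n × Fin 3} (h : cAdj n 3 a b)
    (h' : ¬ pAdj n 3 a b) :
    ((a.1 : ℕ) = 0 ∧ (b.1 : ℕ) + 1 = n) ∨ ((b.1 : ℕ) = 0 ∧ (a.1 : ℕ) + 1 = n) := by
  obtain ⟨h1, h2, h3⟩ := h
  have : ¬ |((a.1 : ℤ) - (b.1 : ℤ))| ≤ 1 := fun h => h' ⟨h1, h, h3⟩
  rw [abs_le] at this
  have := a.1.2
  have := b.1.2
  omega

open Classical in
/-- top of the interval -/
noncomputable def topSet (n : ℕ) (R : Finset (Fin n × Fin 3)) : Finset (Fin n × Fin 3) :=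
  R ∪ Finset.univ.filter (fun v => hub n v ∧ ∀ a ∈ R, ¬ pAdj n 3 v a)

lemma topSet_card {n : ℕ} (hn : 3 ≤ n) {R : Finset (Fin n × Fin 3)}
    (hC : HasEdge (cAdj n 3) R) (hP : ¬ HasEdge (pAdj n 3) R) :
    (n + 4) / 3 ≤ (topSet n R).card := by
  classical
  let g : Fin n × Fin 3 → ℕ := fun a =>
    if (a.1 : ℕ) + 1 = n then (n - 2) / 3 + 1 else ((a.1 : ℕ) + 2) / 3
  have hends : (∃ a ∈ R, (a.1 : ℕ) = 0) ∧ (∃ b ∈ R, (b.1 : ℕ) + 1 = n) := by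
    obtain ⟨a, ha, b, hb, hab⟩ := hC
    rcases cAdj_not_pAdj hab (fun h => hP ⟨a, ha, b, hb, h⟩) with h | h
    · exact ⟨⟨a, ha, h.1⟩, ⟨b, hb, h.2⟩⟩
    · exact ⟨⟨b, hb, h.1⟩, ⟨a, ha, h.2⟩⟩
  have hsub : Finset.range ((n + 4) / 3) ⊆ (topSet n R).image g := by
    intro t ht
    rw [Finset.mem_range] at ht
    rw [Finset.mem_image]
    obtain ⟨⟨a, ha, ha0⟩, ⟨b, hb, hbn⟩⟩ := hends
    by_cases h0 : t = 0
    · refine ⟨a, Finset.mem_union_left _ ha, ?_⟩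
      simp only [g]
      rw [if_neg (by omega)]
      omega
    by_cases h1 : t = (n - 2) / 3 + 1
    · refine ⟨b, Finset.mem_union_left _ hb, ?_⟩
      simp only [g]
      rw [if_pos hbn, h1]
    have hlt : 3 * t - 1 < n := by omega
    let v : Fin n × Fin 3 := (⟨3 * t - 1, hlt⟩, 1)
    by_cases hv : ∀ a ∈ R, ¬ pAdj n 3 v a
    · refine ⟨v, Finset.mem_union_right _ ?_, ?_⟩
      · rw [Finset.mem_filter]
        refine ⟨Finset.mem_univ _, ⟨rfl, ?_, ?_⟩, hv⟩ <;> simp only [v] <;> omega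
      · simp only [g, v]
        rw [if_neg (by omega)]
        omega
    · push Not at hv
      obtain ⟨x, hx, hvx⟩ := hv
      refine ⟨x, Finset.mem_union_left _ hx, ?_⟩
      have h2 := hvx.2.1
      rw [abs_le] at h2
      simp only [v] at h2
      simp only [g]
      rw [if_neg (by omega)]
      omega
  calc (n + 4) / 3 = (Finset.range ((n + 4) / 3)).card := by simp
    _ ≤ _ := Finset.card_le_card hsub
    _ ≤ _ := Finset.card_image_le

lemma topSet_indep {n : ℕ} {R : Finset (Fin n × Fin 3)}
    (hP : ¬ HasEdge (pAdj n 3) R) : ¬ HasEdge (pAdj n 3) (topSet n R) := by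
  classical
  rintro ⟨a, ha, b, hb, hab⟩
  simp only [topSet, Finset.mem_union, Finset.mem_filter, Finset.mem_univ, true_and] at ha hb
  rcases ha with ha | ⟨ha, ha'⟩ <;> rcases hb with hb | ⟨hb, hb'⟩
  · exact hP ⟨a, ha, b, hb, hab⟩
  · exact hb' a ha (pAdj_symm hab)
  · exact ha' b hb hab
  · obtain ⟨h1, h2, h3⟩ := hab
    rw [abs_le] at h2
    obtain ⟨p1, p2, p3⟩ := ha
    obtain ⟨q1, q2, q3⟩ := hb
    apply h1
    refine Prod.ext (Fin.ext ?_) (p1.trans q1.symm)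
    omega

end Strip

/-- For every integer `n ≥ 3`, `sdepth(I(C_{n,3})/I(P_{n,3})) ≥ ⌈(n+2)/3⌉`. -/
theorem sdepth_edgeIdeal_C_quot_P_n_3 (K : Type) [Field K] (n : ℕ) (hn : 3 ≤ n) :
    sdepth K (Fin n × Fin 3)
        (↥(edgeIdeal K (cAdj n 3)) ⧸
          Submodule.comap (edgeIdeal K (cAdj n 3)).subtype (edgeIdeal K (pAdj n 3))) ≥
      (n + 4) / 3 := by
  classical
  let ι := {R : Finset (Fin n × Fin 3) // HasEdge (cAdj n 3) R ∧ ¬ HasEdge (pAdj n 3) R ∧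
    ∀ v ∈ R, ¬ hub n v}
  let e : ι ≃ Fin (Fintype.card ι) := Fintype.equivFin ι
  have hcol : ∀ T : Finset (Fin n × Fin 3), HasEdge (cAdj n 3) T → ¬ HasEdge (pAdj n 3) T →
      HasEdge (cAdj n 3) (T.filter (fun v => ¬ hub n v)) := by
    rintro T ⟨a, ha, b, hb, hab⟩ hT
    have h := cAdj_not_pAdj hab (fun h => hT ⟨a, ha, b, hb, h⟩)
    refine ⟨a, Finset.mem_filter.2 ⟨ha, ?_⟩, b, Finset.mem_filter.2 ⟨hb, ?_⟩, hab⟩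
    · rintro ⟨_, h2, h3⟩
      omega
    · rintro ⟨_, h2, h3⟩
      omega
  have hex : ∀ T : Finset (Fin n × Fin 3), HasEdge (cAdj n 3) T → ¬ HasEdge (pAdj n 3) T →
      ∃ i : ι, i.1 ⊆ T ∧ T ⊆ topSet n i.1 := by
    intro T h1 h2
    refine ⟨⟨T.filter (fun v => ¬ hub n v), hcol T h1 h2,
      fun h => h2 (h.mono (Finset.filter_subset _ _)), ?_⟩, Finset.filter_subset _ _, ?_⟩
    · intro v hv
      exact (Finset.mem_filter.1 hv).2
    · intro v hv
      by_cases hh : hub n v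
      · refine Finset.mem_union_right _ (Finset.mem_filter.2 ⟨Finset.mem_univ _, hh, ?_⟩)
        intro a ha hva
        exact h2 ⟨v, hv, a, (Finset.mem_filter.1 ha).1, hva⟩
      · exact Finset.mem_union_left _ (Finset.mem_filter.2 ⟨hv, hh⟩)
  have hdet : ∀ (T : Finset (Fin n × Fin 3)) (i : ι), i.1 ⊆ T → T ⊆ topSet n i.1 →
      i.1 = T.filter (fun v => ¬ hub n v) := by
    intro T i h1 h2
    ext v
    rw [Finset.mem_filter]
    constructor
    · intro hv
      exact ⟨h1 hv, i.2.2.2 v hv⟩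
    · rintro ⟨hv, hh⟩
      rcases Finset.mem_union.1 (h2 hv) with h | h
      · exact h
      · exact absurd (Finset.mem_filter.1 h).2.1 hh
  refine sdepth_ge_s13 (fun a h => h.1 rfl) (fun a h => h.1 rfl)
    (fun i => (e.symm i).1) (fun i => topSet n (e.symm i).1)
    (fun i => (e.symm i).2.1) (fun i => Finset.subset_union_left)
    (fun i => topSet_indep (e.symm i).2.2.1) ?_ ?_ ?_ _
    (fun i => topSet_card hn (e.symm i).2.1 (e.symm i).2.2.1)
  · intro T h1 h2
    obtain ⟨i, hi⟩ := hex T h1 h2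
    exact ⟨e i, by simpa using hi⟩
  · intro T i j h1 h2 h3 h4
    apply e.symm.injective
    apply Subtype.ext
    rw [hdet T _ h1 h2, hdet T _ h3 h4]
  · let a : Fin n × Fin 3 := (⟨0, by omega⟩, 1)
    let b : Fin n × Fin 3 := (⟨n - 1, by omega⟩, 1)
    have hab : a ≠ b := by
      intro h
      have := congrArg (fun x => (x.1 : ℕ)) h
      simp only [a, b] at this
      omega
    obtain ⟨i, -⟩ := hex {a, b} ⟨a, by simp, b, by simp, hab, by simp only [a, b]; omega, by simp [a, b]⟩ (by
      have key : ∀ x ∈ ({a, b} : Finset (Fin n × Fin 3)), (x.1 : ℕ) = 0 ∧ x = a ∨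
          (x.1 : ℕ) = n - 1 ∧ x = b := by
        intro x hx
        rw [Finset.mem_insert, Finset.mem_singleton] at hx
        rcases hx with rfl | rfl
        · exact Or.inl ⟨rfl, rfl⟩
        · exact Or.inr ⟨rfl, rfl⟩
      rintro ⟨x, hx, y, hy, h1, h2, h3⟩
      rw [abs_le] at h2
      rcases key x hx with ⟨p, p'⟩ | ⟨p, p'⟩ <;> rcases key y hy with ⟨q, q'⟩ | ⟨q, q'⟩
      · exact h1 (p'.trans q'.symm)
      · omega
      · omega
      · exact h1 (p'.trans q'.symm))
    exact Fintype.card_pos_iff.2 ⟨i⟩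
end
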